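/- For every n ≥ 1, the composite Rvac_F ∘ Row_F is conjugate to Flip in the order filter toggle group of A^n: there exists an element g of the subgroup of permutations of F(A^n) generated by the order filter toggles {t_p : p ∈ A^n} such that g ∘ (Rvac_F ∘ Row_F) ∘ g^{−1} = Flip as permutations of F(A^n), where Flip acts on order filters by F ↦ {Flip(p) : p ∈ F}. -/

import Mathlib

open scoped Classical

noncomputable section

/-- `p` represents an interval `[p.1, p.2]` of the poset `Aⁿ` (so `1 ≤ p.1 ≤ p.2 ≤ n`). -/
def AnMem (n : ℕ) (p : ℕ × ℕ) : Prop := 1 ≤ p.1 ∧ p.1 ≤ p.2 ∧ p.2 ≤ n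

/-- The containment order of `Aⁿ`: `AnLe p q` means `[p.1,p.2] ⊆ [q.1,q.2]`,
i.e. `p ≤ q` in `Aⁿ`. -/
def AnLe (p q : ℕ × ℕ) : Prop := q.1 ≤ p.1 ∧ p.2 ≤ q.2

/-- `A` is an antichain of the poset `Aⁿ`: its members are intervals of `[n]`, and no two
distinct members are comparable under containment. -/
def IsAntichainAn (n : ℕ) (A : Finset (ℕ × ℕ)) : Prop :=
  (∀ p ∈ A, AnMem n p) ∧ ∀ p ∈ A, ∀ q ∈ A, p ≠ q → ¬ AnLe p q

/-- The Lalanne–Kreweras involution.  Writing the antichain `A` as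
`{[i₁,j₁],…,[i_k,j_k]}` with `i₁ < ⋯ < i_k` and `j₁ < ⋯ < j_k`, the image `LK A` consists
of the pairs `[i'_ℓ, j'_ℓ]` where `{i'_1 < ⋯ < i'_m} = [n] \ {j₁,…,j_k}` and
`{j'_1 < ⋯ < j'_m} = [n] \ {i₁,…,i_k}`: we zip the increasing enumeration of the
complement of the second coordinates with that of the first coordinates. -/
def LK (n : ℕ) (A : Finset (ℕ × ℕ)) : Finset (ℕ × ℕ) :=
  (List.zip
    ((Finset.Icc 1 n \ A.image Prod.snd).sort (· ≤ ·))
    ((Finset.Icc 1 n \ A.image Prod.fst).sort (· ≤ ·))).toFinset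

instance (n : ℕ) (p : ℕ × ℕ) : Decidable (AnMem n p) := by unfold AnMem; infer_instance

instance (p q : ℕ × ℕ) : Decidable (AnLe p q) := by unfold AnLe; infer_instance

instance (n : ℕ) (A : Finset (ℕ × ℕ)) : Decidable (IsAntichainAn n A) := by
  unfold IsAntichainAn; infer_instance

/-- The set of elements of the poset `Aⁿ`, as a finset of pairs. -/
def AnUniv (n : ℕ) : Finset (ℕ × ℕ) :=
  (Finset.Icc 1 n ×ˢ Finset.Icc 1 n).filter (AnMem n)

/-- `F` is an order filter of `Aⁿ`. -/
def IsOFAn (n : ℕ) (F : Finset (ℕ × ℕ)) : Prop :=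
  (∀ p ∈ F, AnMem n p) ∧ ∀ p ∈ F, ∀ q, AnMem n q → AnLe p q → q ∈ F

/-- The set of order filters of `Aⁿ`. -/
abbrev OFAn (n : ℕ) := {F : Finset (ℕ × ℕ) // IsOFAn n F}

/-- Flip the membership status of `p` in `F`. -/
def ofFlip (p : ℕ × ℕ) (F : Finset (ℕ × ℕ)) : Finset (ℕ × ℕ) :=
  if p ∈ F then F.erase p else insert p F

lemma ofFlip_ofFlip (p : ℕ × ℕ) (F : Finset (ℕ × ℕ)) : ofFlip p (ofFlip p F) = F := by
  unfold ofFlip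
  by_cases hp : p ∈ F
  · rw [if_pos hp, if_neg (by simp), Finset.insert_erase hp]
  · rw [if_neg hp, if_pos (Finset.mem_insert_self p F), Finset.erase_insert hp]

/-- The order filter toggle `t_p`, as a function on order filters: replace `F` by
`F ∪ {p}` (if `p ∉ F`) or `F \ {p}` (if `p ∈ F`) whenever the result is again an
order filter, and do nothing otherwise. -/
def toggleFun (n : ℕ) (p : ℕ × ℕ) (F : OFAn n) : OFAn n :=
  if h : IsOFAn n (ofFlip p F.val) then ⟨ofFlip p F.val, h⟩ else F

lemma toggleFun_invol (n : ℕ) (p : ℕ × ℕ) : Function.Involutive (toggleFun n p) := by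
  intro F
  apply Subtype.ext
  unfold toggleFun
  by_cases h : IsOFAn n (ofFlip p F.val)
  · rw [dif_pos h]
    have h2 : IsOFAn n (ofFlip p (ofFlip p F.val)) := by
      rw [ofFlip_ofFlip]; exact F.2
    rw [dif_pos h2]
    exact ofFlip_ofFlip p F.val
  · rw [dif_neg h, dif_neg h]

/-- The order filter toggle `t_p`, as a permutation of the set of order filters of `Aⁿ`. -/
def togglePerm (n : ℕ) (p : ℕ × ℕ) : Equiv.Perm (OFAn n) :=
  Function.Involutive.toPerm _ (toggleFun_invol n p)

/-- The composition of the toggles along a word of poset elements, as a permutation;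
the head of the list acts last. -/
def wordPerm (n : ℕ) (w : List (ℕ × ℕ)) : Equiv.Perm (OFAn n) :=
  (w.map (togglePerm n)).prod

/-- A list enumerating the elements of rank `i` of `Aⁿ`; since toggles of elements of
equal rank commute, composing along this list (in any order) gives the rank toggle `𝐭_i`. -/
def rankListAn (n i : ℕ) : List (ℕ × ℕ) :=
  ((AnUniv n).filter (fun p => p.2 - p.1 = i)).toList

/-- A word of poset elements realizing a word of rank toggles. -/
def wordOfRanks (n : ℕ) (l : List ℕ) : List (ℕ × ℕ) :=
  l.foldr (fun i acc => rankListAn n i ++ acc) []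

/-- Order filter rowmotion `Row_F = 𝐭_0 𝐭_1 ⋯ 𝐭_r` of `Aⁿ` (where `r = n - 1`),
as a permutation of the set of order filters. -/
def RowPermAn (n : ℕ) : Equiv.Perm (OFAn n) :=
  wordPerm n (wordOfRanks n (List.range n))

/-- Order filter rowvacuation `Rvac_F = (𝐭_r)(𝐭_{r-1} 𝐭_r) ⋯ (𝐭_0 𝐭_1 ⋯ 𝐭_r)` of `Aⁿ`
(where `r = n - 1`), as a permutation of the set of order filters. -/
def RvacPermAn (n : ℕ) : Equiv.Perm (OFAn n) :=
  wordPerm n (wordOfRanks n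
    ((List.range n).foldr (fun k acc => (List.range n).drop (n - 1 - k) ++ acc) []))

/-- The poset automorphism `Flip` of `Aⁿ`, `[i,j] ↦ [n+1-j, n+1-i]`
(reflection of `Aⁿ` across its vertical axis of symmetry), on pairs. -/
def flipPair (n : ℕ) (p : ℕ × ℕ) : ℕ × ℕ := (n + 1 - p.2, n + 1 - p.1)

lemma flipPair_flipPair (n : ℕ) (p : ℕ × ℕ) (h : AnMem n p) :
    flipPair n (flipPair n p) = p := by
  obtain ⟨a, b⟩ := p
  obtain ⟨h1, h2, h3⟩ := h
  unfold flipPair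
  simp only [Prod.mk.injEq]
  simp only [Prod.fst, Prod.snd] at *
  constructor <;> omega

lemma image_flip_flip (n : ℕ) (F : Finset (ℕ × ℕ)) (hF : ∀ p ∈ F, AnMem n p) :
    (F.image (flipPair n)).image (flipPair n) = F := by
  rw [Finset.image_image]
  have h : ∀ p ∈ F, (flipPair n ∘ flipPair n) p = id p := fun p hp =>
    flipPair_flipPair n p (hF p hp)
  rw [Finset.image_congr h, Finset.image_id]

/-- The action of `Flip` on order filters, `F ↦ {Flip p : p ∈ F}`, as a function. -/
def flipFun (n : ℕ) (F : OFAn n) : OFAn n :=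
  if h : IsOFAn n (F.val.image (flipPair n)) then ⟨F.val.image (flipPair n), h⟩ else F

lemma flipFun_invol (n : ℕ) : Function.Involutive (flipFun n) := by
  intro F
  apply Subtype.ext
  unfold flipFun
  by_cases h : IsOFAn n (F.val.image (flipPair n))
  · rw [dif_pos h]
    have h2 : IsOFAn n ((F.val.image (flipPair n)).image (flipPair n)) := by
      rw [image_flip_flip n F.val F.2.1]; exact F.2
    rw [dif_pos h2]
    exact image_flip_flip n F.val F.2.1
  · rw [dif_neg h, dif_neg h]

/-- `Flip` acting on the set of order filters of `Aⁿ`, as a permutation. -/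
def flipPerm (n : ℕ) : Equiv.Perm (OFAn n) :=
  Function.Involutive.toPerm _ (flipFun_invol n)

end

section EvacuationWords

variable {G : Type*} [Group G]

/-- The evacuation word `(t_r)(t_{r-1} t_r) ⋯ (t_0 t_1 ⋯ t_r)` of a list `[t_0, …, t_r]`. -/
def evacProd : List G → G
  | [] => 1
  | a :: l => evacProd l * (a :: l).prod

/-- The product `t_0 t_2 t_4 ⋯` of every other entry of a list `[t_0, t_1, …]`. -/
def altProd : List G → G
  | [] => 1
  | [a] => a
  | a :: _ :: l => a * altProd l

/-- Each entry of the list commutes with all entries that are not next to it. -/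
def FarCommute : List G → Prop
  | [] => True
  | [_] => True
  | a :: b :: l => (∀ x ∈ l, Commute a x) ∧ FarCommute (b :: l)

theorem FarCommute.tail {a : G} {l : List G} (h : FarCommute (a :: l)) : FarCommute l := by
  cases l with
  | nil => trivial
  | cons b l => exact h.2

theorem list_prod_mem_closure {S : Set G} {l : List G} (h : ∀ x ∈ l, x ∈ S) :
    l.prod ∈ Subgroup.closure S :=
  Subgroup.list_prod_mem _ fun x hx => Subgroup.subset_closure (h x hx)

theorem evacProd_mem_closure {S : Set G} {l : List G} (h : ∀ x ∈ l, x ∈ S) :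
    evacProd l ∈ Subgroup.closure S := by
  induction l with
  | nil => exact one_mem _
  | cons a l ih =>
    exact mul_mem (ih fun x hx => h x (List.mem_cons_of_mem _ hx)) (list_prod_mem_closure h)

theorem commute_of_mem_closure {a g : G} {l : List G} (h : ∀ x ∈ l, Commute a x)
    (hg : g ∈ Subgroup.closure {x | x ∈ l}) : Commute a g := by
  induction hg using Subgroup.closure_induction with
  | mem x hx => exact h x hx
  | one => exact Commute.one_right a
  | mul x y _ _ hx hy => exact hx.mul_right hy
  | inv x _ hx => exact hx.inv_right

theorem evacProd_cons_eq_reverse_prod_mul {a : G} {l : List G} (h : FarCommute (a :: l)) :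
    evacProd (a :: l) = (a :: l).reverse.prod * evacProd l := by
  induction l generalizing a with
  | nil => simp [evacProd]
  | cons b l ih =>
    have hc : Commute a (evacProd l) :=
      commute_of_mem_closure h.1 (evacProd_mem_closure fun x hx => hx)
    calc evacProd (a :: b :: l)
        = evacProd (b :: l) * (a * (b :: l).prod) := by rw [evacProd, List.prod_cons]
      _ = (b :: l).reverse.prod * (evacProd l * a) * (b :: l).prod := by
          rw [ih h.tail]; simp only [mul_assoc]
      _ = (b :: l).reverse.prod * (a * evacProd l) * (b :: l).prod := by rw [hc.eq]
      _ = (a :: b :: l).reverse.prod * evacProd (b :: l) := by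
          rw [List.reverse_cons (a := a), List.prod_append, List.prod_singleton]
          conv_rhs => rw [evacProd]
          simp only [mul_assoc]

theorem reverse_prod_eq_inv {l : List G} (h : ∀ x ∈ l, x * x = 1) :
    l.reverse.prod = l.prod⁻¹ := by
  rw [List.prod_inv_reverse]
  congr 2
  symm
  calc l.map (fun x => x⁻¹) = l.map id :=
        List.map_congr_left fun x hx => inv_eq_of_mul_eq_one_left (h x hx)
    _ = l := List.map_id l

/-- An evacuation word in involutions is conjugate to the product of every other one of them. -/
theorem exists_conj_evacProd_eq_altProd (l : List G) (hf : FarCommute l)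
    (hi : ∀ x ∈ l, x * x = 1) :
    ∃ g ∈ Subgroup.closure {x | x ∈ l}, g * evacProd l * g⁻¹ = altProd l := by
  induction l using altProd.induct with
  | case1 => exact ⟨1, one_mem _, by simp [evacProd, altProd]⟩
  | case2 a => exact ⟨1, one_mem _, by simp [evacProd, altProd]⟩
  | case3 a b l ih =>
    obtain ⟨g, hg, hgl⟩ := ih hf.2.tail fun x hx => hi x (by simp [hx])
    refine ⟨g * (b :: l).prod, mul_mem ?_ (list_prod_mem_closure fun x hx => ?_), ?_⟩
    · exact Subgroup.closure_mono (fun x (hx : x ∈ l) => by simp [hx]) hg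
    · exact List.mem_cons_of_mem _ hx
    · have hr : (a :: b :: l).reverse.prod = (b :: l).prod⁻¹ * a := by
        rw [List.reverse_cons, List.prod_append, List.prod_singleton,
          reverse_prod_eq_inv fun x hx => hi x (List.mem_cons_of_mem _ hx)]
      have hc : a * g = g * a := (commute_of_mem_closure hf.1 hg).eq
      rw [evacProd_cons_eq_reverse_prod_mul hf, hr, evacProd, altProd, ← hgl, ← mul_assoc a,
        ← mul_assoc a, hc]
      group

end EvacuationWords

section Toggles

/-- `p` and `q` do not differ by one in exactly one coordinate. -/
def NonAdj (p q : ℕ × ℕ) : Prop :=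
  (p.1 = q.1 → p.2 ≠ q.2 + 1 ∧ q.2 ≠ p.2 + 1) ∧ (p.2 = q.2 → p.1 ≠ q.1 + 1 ∧ q.1 ≠ p.1 + 1)

/-- Whether `p` belongs to the order filter `F` after `F` is toggled at `p`. -/
def ToggledMem (n : ℕ) (p : ℕ × ℕ) (F : Finset (ℕ × ℕ)) : Prop :=
  (p ∈ F ∧ ((p.1 + 1, p.2) ∈ F ∨ (p.1, p.2 - 1) ∈ F)) ∨
    (p ∉ F ∧ (p.1 = 1 ∨ (p.1 - 1, p.2) ∈ F) ∧ (p.2 = n ∨ (p.1, p.2 + 1) ∈ F))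

theorem mem_ofFlip {p x : ℕ × ℕ} {F : Finset (ℕ × ℕ)} :
    x ∈ ofFlip p F ↔ (x = p ∧ p ∉ F) ∨ (x ≠ p ∧ x ∈ F) := by
  unfold ofFlip
  split_ifs with h <;> by_cases hx : x = p <;> simp [h, hx]

theorem isOFAn_ofFlip_iff {n : ℕ} {p : ℕ × ℕ} (hp : AnMem n p) {F : Finset (ℕ × ℕ)}
    (hF : IsOFAn n F) : IsOFAn n (ofFlip p F) ↔ (ToggledMem n p F ↔ p ∉ F) := by
  obtain ⟨a, b⟩ := p
  simp only [AnMem] at hp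
  by_cases h : (a, b) ∈ F
  · have key : (ToggledMem n (a, b) F ↔ (a, b) ∉ F) ↔
        ((a + 1, b) ∉ F ∧ (a, b - 1) ∉ F) := by
      simp only [ToggledMem]; tauto
    rw [key]
    constructor
    · intro hO
      constructor
      · intro hm
        have := hO.2 (a + 1, b) (mem_ofFlip.2 (Or.inr ⟨by simp, hm⟩)) (a, b) hp ⟨by simp, le_rfl⟩
        rw [mem_ofFlip] at this
        tauto
      · intro hm
        have hb := hF.1 _ hm
        simp only [AnMem] at hb
        have := hO.2 (a, b - 1) (mem_ofFlip.2 (Or.inr ⟨by simp; omega, hm⟩)) (a, b) hp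
          ⟨le_rfl, by simp⟩
        rw [mem_ofFlip] at this
        tauto
    · rintro ⟨h1, h2⟩
      refine ⟨fun q hq => ?_, fun x hx y hy hxy => ?_⟩
      · rw [mem_ofFlip] at hq
        rcases hq with hq | hq
        · exact absurd h hq.2
        · exact hF.1 q hq.2
      · rw [mem_ofFlip] at hx ⊢
        have hx2 : x ∈ F ∧ x ≠ (a, b) := by tauto
        refine Or.inr ⟨?_, hF.2 x hx2.1 y hy hxy⟩
        rintro rfl
        obtain ⟨c, d⟩ := x
        have hcd := hF.1 _ hx2.1
        simp only [AnLe, AnMem, ne_eq, Prod.mk.injEq] at hxy hcd hx2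
        by_cases hc : c = a
        · exact h2 (hF.2 (c, d) hx2.1 _ (by simp only [AnMem]; omega)
            (by simp only [AnLe]; omega))
        · exact h1 (hF.2 (c, d) hx2.1 _ (by simp only [AnMem]; omega)
            (by simp only [AnLe]; omega))
  · have key : (ToggledMem n (a, b) F ↔ (a, b) ∉ F) ↔
        ((a = 1 ∨ (a - 1, b) ∈ F) ∧ (b = n ∨ (a, b + 1) ∈ F)) := by
      simp only [ToggledMem]; tauto
    rw [key]
    constructor
    · intro hO
      have hm : (a, b) ∈ ofFlip (a, b) F := mem_ofFlip.2 (Or.inl ⟨rfl, h⟩)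
      constructor
      · refine or_iff_not_imp_left.2 fun ha => ?_
        have := hO.2 _ hm (a - 1, b) (by simp only [AnMem]; omega) (by simp only [AnLe]; omega)
        rw [mem_ofFlip] at this
        simp only [Prod.mk.injEq] at this
        rcases this with this | this
        · omega
        · exact this.2
      · refine or_iff_not_imp_left.2 fun ha => ?_
        have := hO.2 _ hm (a, b + 1) (by simp only [AnMem]; omega) (by simp only [AnLe]; omega)
        rw [mem_ofFlip] at this
        simp only [Prod.mk.injEq] at this
        rcases this with this | this
        · omega
        · exact this.2
    · rintro ⟨h1, h2⟩
      refine ⟨fun q hq => ?_, fun x hx y hy hxy => ?_⟩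
      · rw [mem_ofFlip] at hq
        rcases hq with hq | hq
        · rw [hq.1]; exact hp
        · exact hF.1 q hq.2
      · rw [mem_ofFlip] at hx ⊢
        by_cases hyp : y = (a, b)
        · exact Or.inl ⟨hyp, h⟩
        refine Or.inr ⟨hyp, ?_⟩
        rcases hx with hx | hx
        · obtain ⟨c, d⟩ := y
          rw [hx.1] at hxy
          simp only [AnLe, AnMem, Prod.mk.injEq] at hxy hy hyp
          by_cases hc : c = a
          · have h2' : (a, b + 1) ∈ F := by
              rcases h2 with h2 | h2
              · omega
              · exact h2
            exact hF.2 _ h2' _ (by simp only [AnMem]; omega) (by simp only [AnLe]; omega)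
          · have h1' : (a - 1, b) ∈ F := by
              rcases h1 with h1 | h1
              · omega
              · exact h1
            exact hF.2 _ h1' _ (by simp only [AnMem]; omega) (by simp only [AnLe]; omega)
        · exact hF.2 x hx.2 y hy hxy

theorem mem_togglePerm {n : ℕ} {p : ℕ × ℕ} (hp : AnMem n p) (F : OFAn n) (x : ℕ × ℕ) :
    x ∈ (togglePerm n p F).val ↔ (x = p ∧ ToggledMem n p F.val) ∨ (x ≠ p ∧ x ∈ F.val) := by
  change x ∈ (toggleFun n p F).val ↔ _
  unfold toggleFun
  have h := isOFAn_ofFlip_iff hp F.2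
  split_ifs with hO
  · rw [mem_ofFlip, h.1 hO]
  · by_cases hx : x = p
    · subst hx; tauto
    · simp [hx]

theorem toggledMem_congr {n : ℕ} {p : ℕ × ℕ} (hp : AnMem n p) {F F' : Finset (ℕ × ℕ)}
    (h : ∀ q, ¬ NonAdj p q ∨ q = p → (q ∈ F ↔ q ∈ F')) :
    ToggledMem n p F ↔ ToggledMem n p F' := by
  obtain ⟨a, b⟩ := p
  simp only [AnMem] at hp
  unfold ToggledMem
  rw [h (a, b) (Or.inr rfl), h (a + 1, b) (Or.inl (by simp [NonAdj])),
    h (a, b - 1) (Or.inl fun hN => (hN.1 rfl).1 (Nat.sub_add_cancel (by omega)).symm),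
    h (a - 1, b) (Or.inl fun hN => (hN.2 rfl).1 (Nat.sub_add_cancel hp.1).symm),
    h (a, b + 1) (Or.inl (by simp [NonAdj]))]

/-- Duplicate-free lists of pairwise non-adjacent elements of `Aⁿ`. -/
structure IsSparse (n : ℕ) (L : List (ℕ × ℕ)) : Prop where
  nodup : L.Nodup
  mem : ∀ p ∈ L, AnMem n p
  nonAdj : ∀ p ∈ L, ∀ q ∈ L, NonAdj p q

theorem IsSparse.of_cons {n : ℕ} {p : ℕ × ℕ} {L : List (ℕ × ℕ)} (h : IsSparse n (p :: L)) :
    IsSparse n L :=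
  ⟨(List.nodup_cons.1 h.nodup).2, fun q hq => h.mem q (List.mem_cons_of_mem _ hq),
    fun q hq r hr => h.nonAdj q (List.mem_cons_of_mem _ hq) r (List.mem_cons_of_mem _ hr)⟩

theorem wordPerm_cons (n : ℕ) (p : ℕ × ℕ) (L : List (ℕ × ℕ)) :
    wordPerm n (p :: L) = togglePerm n p * wordPerm n L := by
  simp [wordPerm]

theorem wordPerm_append (n : ℕ) (L M : List (ℕ × ℕ)) :
    wordPerm n (L ++ M) = wordPerm n L * wordPerm n M := by
  simp [wordPerm]

/-- The toggles of a sparse list act simultaneously. -/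
theorem IsSparse.mem_wordPerm {n : ℕ} {L : List (ℕ × ℕ)} (h : IsSparse n L) (F : OFAn n)
    (x : ℕ × ℕ) :
    x ∈ (wordPerm n L F).val ↔ (x ∈ L ∧ ToggledMem n x F.val) ∨ (x ∉ L ∧ x ∈ F.val) := by
  induction L generalizing x with
  | nil => simp [wordPerm]
  | cons p L ih =>
    have hp := h.mem p (by simp)
    have hpL := (List.nodup_cons.1 h.nodup).1
    have hT : ToggledMem n p (wordPerm n L F).val ↔ ToggledMem n p F.val := by
      refine toggledMem_congr hp fun q hq => ?_
      rw [ih h.of_cons]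
      have : q ∉ L := by
        rcases hq with hq | rfl
        · exact fun hqL => hq (h.nonAdj p (by simp) q (by simp [hqL]))
        · exact hpL
      tauto
    rw [wordPerm_cons, Equiv.Perm.mul_apply, mem_togglePerm hp, hT, ih h.of_cons,
      List.mem_cons]
    by_cases hx : x = p
    · subst hx; tauto
    · tauto

theorem IsSparse.wordPerm_congr {n : ℕ} {L M : List (ℕ × ℕ)} (hL : IsSparse n L)
    (hM : IsSparse n M) (h : ∀ x, x ∈ L ↔ x ∈ M) : wordPerm n L = wordPerm n M := by
  ext F x
  rw [hL.mem_wordPerm, hM.mem_wordPerm, h]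

theorem IsSparse.of_perm {n : ℕ} {L M : List (ℕ × ℕ)} (hL : IsSparse n L) (h : L.Perm M) :
    IsSparse n M :=
  ⟨h.nodup_iff.1 hL.nodup, fun p hp => hL.mem p (h.mem_iff.2 hp),
    fun p hp q hq => hL.nonAdj p (h.mem_iff.2 hp) q (h.mem_iff.2 hq)⟩

theorem IsSparse.wordPerm_perm {n : ℕ} {L M : List (ℕ × ℕ)} (hL : IsSparse n L)
    (h : L.Perm M) : wordPerm n L = wordPerm n M :=
  hL.wordPerm_congr (hL.of_perm h) fun _ => h.mem_iff

theorem togglePerm_mul_self (n : ℕ) (p : ℕ × ℕ) : togglePerm n p * togglePerm n p = 1 :=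
  Equiv.ext (toggleFun_invol n p)

theorem IsSparse.wordPerm_mul_self {n : ℕ} {L : List (ℕ × ℕ)} (hL : IsSparse n L) :
    wordPerm n L * wordPerm n L = 1 := by
  nth_rewrite 1 [hL.wordPerm_perm (List.reverse_perm L).symm]
  unfold wordPerm
  rw [List.map_reverse, reverse_prod_eq_inv, inv_mul_cancel]
  intro x hx
  obtain ⟨p, -, rfl⟩ := List.mem_map.1 hx
  exact togglePerm_mul_self n p

theorem IsSparse.commute_wordPerm {n : ℕ} {L M : List (ℕ × ℕ)} (h : IsSparse n (L ++ M)) :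
    Commute (wordPerm n L) (wordPerm n M) := by
  change _ * _ = _ * _
  rw [← wordPerm_append, ← wordPerm_append]
  exact h.wordPerm_perm List.perm_append_comm

theorem wordPerm_mem_closure {n : ℕ} {L : List (ℕ × ℕ)} (h : ∀ p ∈ L, AnMem n p) :
    wordPerm n L ∈
      Subgroup.closure ((fun p => togglePerm n p) '' {p : ℕ × ℕ | AnMem n p}) := by
  refine list_prod_mem_closure fun x hx => ?_
  obtain ⟨p, hp, rfl⟩ := List.mem_map.1 hx
  exact ⟨p, h p hp, rfl⟩

end Toggles

section Layers

theorem mem_AnUniv {n : ℕ} {p : ℕ × ℕ} : p ∈ AnUniv n ↔ AnMem n p := by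
  simp only [AnUniv, Finset.mem_filter, Finset.mem_product, Finset.mem_Icc, AnMem]
  omega

/-- The elements of `Aⁿ` on which the function `κ` takes the value `k`. -/
noncomputable def layer (n : ℕ) (κ : ℕ × ℕ → ℕ) (k : ℕ) : List (ℕ × ℕ) :=
  ((AnUniv n).filter (fun p => κ p = k)).toList

theorem mem_layer {n : ℕ} {κ : ℕ × ℕ → ℕ} {k : ℕ} {p : ℕ × ℕ} :
    p ∈ layer n κ k ↔ AnMem n p ∧ κ p = k := by
  simp [layer, mem_AnUniv]

theorem nodup_layer (n : ℕ) (κ : ℕ × ℕ → ℕ) (k : ℕ) : (layer n κ k).Nodup :=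
  Finset.nodup_toList _

/-- Adjacent elements of `Aⁿ` lie in layers of `κ` of consecutive indices. -/
def IsLayering (n : ℕ) (κ : ℕ × ℕ → ℕ) : Prop :=
  ∀ p q, AnMem n p → AnMem n q → κ p ≠ κ q + 1 → κ q ≠ κ p + 1 → NonAdj p q

theorem IsLayering.isSparse_layer {n : ℕ} {κ : ℕ × ℕ → ℕ} (h : IsLayering n κ) (k : ℕ) :
    IsSparse n (layer n κ k) := by
  refine ⟨nodup_layer n κ k, fun p hp => (mem_layer.1 hp).1, fun p hp q hq => ?_⟩
  rw [mem_layer] at hp hq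
  exact h p q hp.1 hq.1 (by omega) (by omega)

theorem IsLayering.commute {n : ℕ} {κ : ℕ × ℕ → ℕ} (h : IsLayering n κ) {j k : ℕ}
    (hjk : j + 2 ≤ k) : Commute (wordPerm n (layer n κ k)) (wordPerm n (layer n κ j)) := by
  apply IsSparse.commute_wordPerm
  refine ⟨?_, ?_, ?_⟩
  · refine (nodup_layer n κ k).append (nodup_layer n κ j) fun p hp hq => ?_
    rw [mem_layer] at hp hq
    omega
  · intro p hp
    rw [List.mem_append, mem_layer, mem_layer] at hp
    tauto
  · intro p hp q hq
    rw [List.mem_append, mem_layer, mem_layer] at hp hq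
    exact h p q (by tauto) (by tauto) (by omega) (by omega)

/-- The layer toggles of indices `r, r - 1, …, 1`. -/
noncomputable def layerToggles (n : ℕ) (κ : ℕ × ℕ → ℕ) : ℕ → List (Equiv.Perm (OFAn n))
  | 0 => []
  | r + 1 => wordPerm n (layer n κ (r + 1)) :: layerToggles n κ r

theorem mem_layerToggles {n : ℕ} {κ : ℕ × ℕ → ℕ} {r : ℕ} {x : Equiv.Perm (OFAn n)} :
    x ∈ layerToggles n κ r ↔ ∃ k, 1 ≤ k ∧ k ≤ r ∧ x = wordPerm n (layer n κ k) := by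
  induction r with
  | zero => simp only [layerToggles, List.not_mem_nil, false_iff]; rintro ⟨k, h1, h2, -⟩; omega
  | succ r ih =>
    rw [layerToggles, List.mem_cons, ih]
    constructor
    · rintro (rfl | ⟨k, h1, h2, rfl⟩)
      · exact ⟨r + 1, by omega, le_rfl, rfl⟩
      · exact ⟨k, h1, by omega, rfl⟩
    · rintro ⟨k, h1, h2, rfl⟩
      rcases Nat.lt_or_ge r k with hk | hk
      · obtain rfl : k = r + 1 := by omega
        exact Or.inl rfl
      · exact Or.inr ⟨k, h1, hk, rfl⟩

theorem IsLayering.farCommute {n : ℕ} {κ : ℕ × ℕ → ℕ} (h : IsLayering n κ) (r : ℕ) :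
    FarCommute (layerToggles n κ r) := by
  induction r with
  | zero => trivial
  | succ r ih =>
    cases r with
    | zero => trivial
    | succ r =>
      refine ⟨fun x hx => ?_, ih⟩
      obtain ⟨k, -, hk, rfl⟩ := mem_layerToggles.1 hx
      exact h.commute (by omega)

theorem IsLayering.exists_altProd_eq {n : ℕ} {κ : ℕ × ℕ → ℕ} (h : IsLayering n κ) (r : ℕ) :
    ∃ L, IsSparse n L ∧ altProd (layerToggles n κ r) = wordPerm n L ∧
      ∀ p, p ∈ L ↔ AnMem n p ∧ 1 ≤ κ p ∧ κ p ≤ r ∧ κ p % 2 = r % 2 := by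
  induction r using Nat.twoStepInduction with
  | zero =>
    refine ⟨[], ⟨List.nodup_nil, by simp, by simp⟩, by simp [layerToggles, altProd, wordPerm], ?_⟩
    intro p
    simp only [List.not_mem_nil, false_iff]
    omega
  | one =>
    refine ⟨layer n κ 1, h.isSparse_layer 1, by simp [layerToggles, altProd], fun p => ?_⟩
    rw [mem_layer]
    constructor <;> rintro ⟨h1, h2⟩ <;> exact ⟨h1, by omega⟩
  | more r ih _ =>
    obtain ⟨L, hL, hprod, hmem⟩ := ih
    have hmem' : ∀ p, p ∈ layer n κ (r + 2) ++ L ↔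
        AnMem n p ∧ 1 ≤ κ p ∧ κ p ≤ r + 2 ∧ κ p % 2 = (r + 2) % 2 := by
      intro p
      rw [List.mem_append, mem_layer, hmem, ← and_or_left]
      exact and_congr_right fun _ => by omega
    refine ⟨layer n κ (r + 2) ++ L, ⟨?_, fun p hp => ((hmem' p).1 hp).1, ?_⟩, ?_, hmem'⟩
    · refine (nodup_layer n κ _).append hL.nodup fun p hp hq => ?_
      rw [mem_layer] at hp
      rw [hmem] at hq
      omega
    · intro p hp q hq
      rw [hmem'] at hp hq
      exact h p q hp.1 hq.1 (by omega) (by omega)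
    · rw [wordPerm_append, ← hprod]
      rfl

theorem IsLayering.exists_conj {n : ℕ} {κ : ℕ × ℕ → ℕ} (h : IsLayering n κ) (r : ℕ) :
    ∃ g ∈ Subgroup.closure ((fun p => togglePerm n p) '' {p : ℕ × ℕ | AnMem n p}),
      g * evacProd (layerToggles n κ r) * g⁻¹ = altProd (layerToggles n κ r) := by
  obtain ⟨g, hg, e⟩ := exists_conj_evacProd_eq_altProd _ (h.farCommute r) fun x hx => by
    obtain ⟨k, -, -, rfl⟩ := mem_layerToggles.1 hx
    exact (h.isSparse_layer k).wordPerm_mul_self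
  refine ⟨g, (Subgroup.closure_le _).2 ?_ hg, e⟩
  intro x hx
  obtain ⟨k, -, -, rfl⟩ := mem_layerToggles.1 hx
  exact wordPerm_mem_closure fun p hp => (mem_layer.1 hp).1

end Layers

section Rows

/-- The corank of an interval, shifted so that maximal elements have index `1`. -/
def corank (n : ℕ) (p : ℕ × ℕ) : ℕ := n - (p.2 - p.1)

theorem isLayering_corank (n : ℕ) : IsLayering n (corank n) := by
  rintro ⟨a, b⟩ ⟨c, d⟩ hp hq h1 h2
  simp only [AnMem, corank, NonAdj] at *
  omega

theorem wordPerm_wordOfRanks (n : ℕ) (l : List ℕ) :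
    wordPerm n (wordOfRanks n l) = (l.map fun i => wordPerm n (rankListAn n i)).prod := by
  induction l with
  | nil => rfl
  | cons a l ih =>
    rw [List.map_cons, List.prod_cons, ← ih, ← wordPerm_append]
    rfl

theorem foldr_append_eq_flatMap {α β : Type*} (f : α → List β) (l : List α) :
    l.foldr (fun k acc => f k ++ acc) [] = l.flatMap f := by
  induction l with
  | nil => rfl
  | cons a l ih => rw [List.foldr_cons, ih, List.flatMap_cons]

theorem evacProd_map_drop_range {G : Type*} [Group G] (T : ℕ → G) {n j : ℕ} (hj : j ≤ n) :
    (((List.range j).flatMap fun k => (List.range n).drop (n - 1 - k)).map T).prod =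
      evacProd (((List.range n).drop (n - j)).map T) := by
  induction j with
  | zero => rw [Nat.sub_zero, List.drop_of_length_le (by simp)]; rfl
  | succ j ih =>
    have hd : (List.range n).drop (n - 1 - j) =
        (n - 1 - j) :: (List.range n).drop (n - j) := by
      rw [List.drop_eq_getElem_cons (by simp; omega), List.getElem_range]
      congr 2
      omega
    have e : n - (j + 1) = n - 1 - j := by omega
    rw [List.range_succ, List.flatMap_append, List.map_append, List.prod_append, ih (by omega), e]
    simp only [List.flatMap_cons, List.flatMap_nil, List.append_nil]
    rw [hd, List.map_cons, evacProd]

theorem RvacPermAn_eq_evacProd (n : ℕ) :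
    RvacPermAn n = evacProd ((List.range n).map fun i => wordPerm n (rankListAn n i)) := by
  unfold RvacPermAn
  rw [wordPerm_wordOfRanks, foldr_append_eq_flatMap, evacProd_map_drop_range _ le_rfl]
  simp

theorem layerToggles_eq_map (n : ℕ) (κ : ℕ × ℕ → ℕ) (r : ℕ) :
    layerToggles n κ r = (List.range r).map fun i => wordPerm n (layer n κ (r - i)) := by
  induction r with
  | zero => rfl
  | succ r ih =>
    rw [layerToggles, ih, List.range_succ_eq_map, List.map_cons, List.map_map]
    simp [Function.comp_def]

theorem layer_corank_eq_rankListAn {n i : ℕ} (hi : i < n) :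
    layer n (corank n) (n - i) = rankListAn n i := by
  unfold layer rankListAn
  congr 1
  refine Finset.filter_congr fun p hp => ?_
  rw [mem_AnUniv] at hp
  simp only [AnMem, corank] at *
  omega

theorem layer_corank_succ (n : ℕ) : layer n (corank n) (n + 1) = [] := by
  rw [List.eq_nil_iff_forall_not_mem]
  intro p hp
  rw [mem_layer] at hp
  simp only [corank] at hp
  omega

theorem RvacPermAn_mul_RowPermAn (n : ℕ) :
    RvacPermAn n * RowPermAn n = evacProd (layerToggles n (corank n) (n + 1)) := by
  have hl : layerToggles n (corank n) n =
      (List.range n).map fun i => wordPerm n (rankListAn n i) := by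
    rw [layerToggles_eq_map]
    refine List.map_congr_left fun i hi => ?_
    rw [layer_corank_eq_rankListAn (List.mem_range.1 hi)]
  have h1 : wordPerm n [] = 1 := rfl
  rw [layerToggles, layer_corank_succ, h1, evacProd, List.prod_cons, one_mul, hl,
    ← RvacPermAn_eq_evacProd, RowPermAn, wordPerm_wordOfRanks]

end Rows

section Growth

/-- The minimum of `h i, …, h (i + d)`. -/
def runMin (h : ℕ → ℤ) (i : ℕ) : ℕ → ℤ
  | 0 => h i
  | d + 1 => min (runMin h i d) (h (i + d + 1))

theorem runMin_succ_left (h : ℕ → ℤ) (i d : ℕ) :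
    runMin h i (d + 1) = min (h i) (runMin h (i + 1) d) := by
  induction d with
  | zero => rfl
  | succ d ih =>
    rw [runMin, ih, runMin, min_assoc]
    congr 3
    omega

theorem runMin_le_left (h : ℕ → ℤ) (i d : ℕ) : runMin h i d ≤ h i := by
  cases d with
  | zero => exact le_rfl
  | succ d => rw [runMin_succ_left]; exact min_le_left _ _

theorem runMin_le_right (h : ℕ → ℤ) (i d : ℕ) : runMin h i d ≤ h (i + d) := by
  cases d with
  | zero => exact le_rfl
  | succ d => exact min_le_right _ _

theorem runMin_nonneg {h : ℕ → ℤ} (h0 : ∀ k, 0 ≤ h k) (i d : ℕ) : 0 ≤ runMin h i d := by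
  induction d with
  | zero => exact h0 i
  | succ d ih => exact le_min ih (h0 _)

/-- The distance between the vertices `i` and `i + d` of the plane tree with contour `h`. -/
def treeDist (h : ℕ → ℤ) (i d : ℕ) : ℤ := h i + h (i + d) - 2 * runMin h i d

theorem treeDist_zero (h : ℕ → ℤ) (i : ℕ) : treeDist h i 0 = 0 := by
  simp only [treeDist, runMin, add_zero]; ring

/-- The distances in a plane tree form a growth diagram. -/
theorem treeDist_growth {h : ℕ → ℤ} {i d : ℕ} (hi : |h (i + 1) - h i| = 1)
    (hj : |h (i + 1 + d + 1) - h (i + 1 + d)| = 1) :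
    treeDist h (i + 1) (d + 1) =
      |treeDist h (i + 1) d + treeDist h i (d + 2) - treeDist h i (d + 1)| := by
  have e1 : runMin h i (d + 2) = min (h i) (min (runMin h (i + 1) d) (h (i + 1 + d + 1))) := by
    rw [runMin_succ_left, runMin]
  have e2 := runMin_succ_left h i d
  have e3 : runMin h (i + 1) (d + 1) = min (runMin h (i + 1) d) (h (i + 1 + d + 1)) := rfl
  have l1 := runMin_le_left h (i + 1) d
  have l2 := runMin_le_right h (i + 1) d
  unfold treeDist
  rw [e1, e2, e3]
  have a1 : i + (d + 2) = i + 1 + d + 1 := by omega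
  have a2 : i + (d + 1) = i + 1 + d := by omega
  have a3 : i + 1 + (d + 1) = i + 1 + d + 1 := by omega
  rw [a1, a2, a3]
  generalize h (i + 1 + d + 1) = w at *
  generalize h (i + 1 + d) = z at *
  generalize h (i + 1) = y at *
  generalize h i = x at *
  generalize runMin h (i + 1) d = μ at *
  rw [abs_eq (by norm_num)] at hi hj
  symm
  rw [abs_eq (by omega)]
  omega

/-- The Dyck paths of length `2n + 2`, recorded by their heights. -/
structure IsDyck (n : ℕ) (h : ℕ → ℤ) : Prop where
  nonneg : ∀ k, 0 ≤ h k
  zero : h 0 = 0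
  last : h (2 * n + 2) = 0
  step : ∀ k, k < 2 * n + 2 → |h (k + 1) - h k| = 1

theorem IsDyck.le {n : ℕ} {h : ℕ → ℤ} (hd : IsDyck n h) {k : ℕ} (hk : k ≤ 2 * n + 2) :
    h k ≤ k ∧ h k % 2 = k % 2 := by
  induction k with
  | zero => simp [hd.zero]
  | succ k ih =>
    have := hd.step k (by omega)
    have := ih (by omega)
    rw [abs_eq (by norm_num)] at *
    push_cast
    omega

theorem IsDyck.le_sub {n : ℕ} {h : ℕ → ℤ} (hd : IsDyck n h) {k : ℕ} (hk : k ≤ 2 * n + 2) :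
    h (2 * n + 2 - k) ≤ k := by
  induction k with
  | zero => simp [hd.last]
  | succ k ih =>
    have h1 := hd.step (2 * n + 2 - (k + 1)) (by omega)
    have h2 := ih (by omega)
    have e : 2 * n + 2 - (k + 1) + 1 = 2 * n + 2 - k := by omega
    rw [e, abs_eq (by norm_num)] at h1
    omega

/-- Toggling the vertex `k` of a Dyck path. -/
def pathToggle (k : ℕ) (h : ℕ → ℤ) : ℕ → ℤ :=
  Function.update h k |h (k - 1) + h (k + 1) - h k|

theorem IsDyck.pathToggle {n : ℕ} {h : ℕ → ℤ} (hd : IsDyck n h) {k : ℕ} (h1 : 1 ≤ k)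
    (h2 : k ≤ 2 * n + 1) : IsDyck n (pathToggle k h) := by
  have s1 := hd.step (k - 1) (by omega)
  have s2 := hd.step k (by omega)
  rw [Nat.sub_add_cancel h1] at s1
  have p0 := hd.nonneg (k - 1)
  have p1 := hd.nonneg (k + 1)
  refine ⟨fun j => ?_, ?_, ?_, fun j hj => ?_⟩
  · unfold _root_.pathToggle
    rw [Function.update_apply]
    split_ifs
    · exact abs_nonneg _
    · exact hd.nonneg j
  · unfold _root_.pathToggle
    rw [Function.update_of_ne (by omega)]; exact hd.zero
  · unfold _root_.pathToggle
    rw [Function.update_of_ne (by omega)]; exact hd.last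
  · unfold _root_.pathToggle
    rw [Function.update_apply, Function.update_apply]
    have p2 := hd.nonneg k
    rcases eq_or_ne j k with rfl | hjk
    · rw [if_neg (by omega), if_pos rfl]
      rw [abs_eq (by norm_num)] at *
      rcases abs_cases (h (j - 1) + h (j + 1) - h j) with h3 | h3 <;> omega
    · rcases eq_or_ne (j + 1) k with rfl | hjk'
      · rw [if_pos rfl, if_neg hjk]
        simp only [Nat.add_sub_cancel] at *
        rw [abs_eq (by norm_num)] at *
        rcases abs_cases (h j + h (j + 1 + 1) - h (j + 1)) with h3 | h3 <;> omega
      · rw [if_neg hjk', if_neg hjk]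
        exact hd.step j hj

/-- Toggling the vertices `1, …, r` of a Dyck path, in this order. -/
def pathSweep : ℕ → (ℕ → ℤ) → ℕ → ℤ
  | 0, h => h
  | r + 1, h => pathToggle (r + 1) (pathSweep r h)

/-- The sweeps over `1, …, r`, then over `1, …, r - 1`, and so on. -/
def pathEvac : ℕ → (ℕ → ℤ) → ℕ → ℤ
  | 0, h => h
  | r + 1, h => pathEvac r (pathSweep (r + 1) h)

/-- The path through the growth diagram of `h` that runs along row `i` and then up the last
column. -/
def growthPath (m : ℕ) (h : ℕ → ℤ) (i k : ℕ) : ℤ :=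
  if k + i ≤ m then treeDist h i k else treeDist h (m - k) (m - (m - k))

theorem pathSweep_growthPath {m : ℕ} {h : ℕ → ℤ} (hs : ∀ k, k < m → |h (k + 1) - h k| = 1)
    {i t : ℕ} (ht : t + i + 1 ≤ m) (k : ℕ) :
    pathSweep t (growthPath m h i) k =
      if k ≤ t then treeDist h (i + 1) k else growthPath m h i k := by
  induction t generalizing k with
  | zero =>
    split_ifs with hk
    · obtain rfl : k = 0 := by omega
      simp only [pathSweep, growthPath]
      rw [if_pos (by omega), treeDist_zero, treeDist_zero]
    · rfl
  | succ t ih =>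
    have ih := ih (by omega)
    rw [pathSweep, pathToggle, Function.update_apply]
    split_ifs with h1 h2 h3
    · subst h1
      rw [ih, ih, ih, if_pos (by omega), if_neg (by omega), if_neg (by omega), growthPath,
        growthPath, if_pos (by omega), if_pos (by omega)]
      exact (treeDist_growth (hs _ (by omega)) (hs _ (by omega))).symm
    · omega
    · rw [ih, if_pos (by omega)]
    · rw [ih, if_neg (by omega)]

theorem pathSweep_growthPath_eq {m : ℕ} {h : ℕ → ℤ}
    (hs : ∀ k, k < m → |h (k + 1) - h k| = 1) {i r : ℕ} (hr : r + i + 1 = m) :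
    pathSweep r (growthPath m h i) = growthPath m h (i + 1) := by
  funext k
  rw [pathSweep_growthPath hs hr.le]
  unfold growthPath
  split_ifs with h1 h2 h3 h4
  · rfl
  · omega
  · obtain rfl : k = m - i := by omega
    omega
  · have e : m - k = i := by omega
    rw [e]
    congr 1
    omega
  · omega
  · rfl

theorem pathEvac_growthPath {m : ℕ} {h : ℕ → ℤ} (hs : ∀ k, k < m → |h (k + 1) - h k| = 1)
    {i r : ℕ} (hr : r + i + 1 = m) :
    pathEvac r (growthPath m h i) = growthPath m h (m - 1) := by
  induction r generalizing i with
  | zero =>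
    obtain rfl : i = m - 1 := by omega
    rfl
  | succ r ih =>
    rw [pathEvac, pathSweep_growthPath_eq hs hr, ih (by omega)]

theorem IsDyck.treeDist_zero_left {n : ℕ} {h : ℕ → ℤ} (hd : IsDyck n h) (k : ℕ) :
    treeDist h 0 k = h k := by
  have h1 := runMin_nonneg hd.nonneg 0 k
  have h2 := runMin_le_left h 0 k
  rw [hd.zero] at h2
  simp only [treeDist, hd.zero, le_antisymm h2 h1, zero_add]
  ring

theorem IsDyck.treeDist_last {n : ℕ} {h : ℕ → ℤ} (hd : IsDyck n h) {i d : ℕ}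
    (hi : i + d = 2 * n + 2) : treeDist h i d = h i := by
  have h1 := runMin_nonneg hd.nonneg i d
  have h2 := runMin_le_right h i d
  rw [hi, hd.last] at h2
  simp only [treeDist, hi, hd.last, le_antisymm h2 h1]
  ring

theorem IsDyck.growthPath_zero {n : ℕ} {h : ℕ → ℤ} (hd : IsDyck n h) {k : ℕ}
    (hk : k ≤ 2 * n + 2) : growthPath (2 * n + 2) h 0 k = h k := by
  rw [growthPath, if_pos (by omega), hd.treeDist_zero_left]

theorem IsDyck.growthPath_last {n : ℕ} {h : ℕ → ℤ} (hd : IsDyck n h) {k : ℕ}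
    (hk : 1 ≤ k) (hk' : k ≤ 2 * n + 2) :
    growthPath (2 * n + 2) h (2 * n + 2 - 1) k = h (2 * n + 2 - k) := by
  unfold growthPath
  split_ifs with h1
  · obtain rfl : k = 1 := by omega
    exact hd.treeDist_last (by omega)
  · exact hd.treeDist_last (by omega)

end Growth

section Columns

/-- The order filter `F` consists of the intervals lying above the Dyck path `h`. -/
structure IsContour (n : ℕ) (F : OFAn n) (h : ℕ → ℤ) : Prop where
  isDyck : IsDyck n h
  mem_iff : ∀ p, p ∈ F.val ↔ AnMem n p ∧ h (p.1 + p.2) + p.1 ≤ p.2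

/-- The column of an interval. -/
def column (p : ℕ × ℕ) : ℕ := p.1 + p.2

theorem isLayering_column (n : ℕ) : IsLayering n column := by
  rintro ⟨a, b⟩ ⟨c, d⟩ hp hq h1 h2
  simp only [AnMem, column, NonAdj] at *
  omega

theorem IsContour.congr {n : ℕ} {F : OFAn n} {h h' : ℕ → ℤ} (hF : IsContour n F h)
    (hd : IsDyck n h') (e : ∀ k, k ≤ 2 * n + 2 → h k = h' k) : IsContour n F h' := by
  refine ⟨hd, fun p => ?_⟩
  rw [hF.mem_iff]
  refine and_congr_right fun hp => ?_
  rw [e _ (by have := hp.2.1; have := hp.2.2; omega)]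

theorem IsContour.wordPerm_layer {n : ℕ} {F : OFAn n} {h : ℕ → ℤ} (hF : IsContour n F h)
    {k : ℕ} (h1 : 1 ≤ k) (h2 : k ≤ 2 * n + 1) :
    IsContour n (wordPerm n (layer n column k) F) (pathToggle k h) := by
  refine ⟨hF.isDyck.pathToggle h1 h2, ?_⟩
  rintro ⟨a, b⟩
  rw [((isLayering_column n).isSparse_layer k).mem_wordPerm, mem_layer]
  by_cases hp : AnMem n (a, b)
  · by_cases hk : a + b = k
    · subst hk
      simp only [AnMem] at hp
      have s1 := hF.isDyck.step (a + b - 1) (by omega)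
      have s2 := hF.isDyck.step (a + b) (by omega)
      have l1 := hF.isDyck.le (k := a + b - 1) (by omega)
      have l2 := hF.isDyck.le (k := a + b) (by omega)
      have l3 := hF.isDyck.le_sub (k := 2 * n + 2 - (a + b + 1)) (by omega)
      have n1 := hF.isDyck.nonneg (a + b)
      have n2 := hF.isDyck.nonneg (a + b - 1)
      have n3 := hF.isDyck.nonneg (a + b + 1)
      have e1 : a + 1 + b = a + b + 1 := by omega
      have e2 : a + (b - 1) = a + b - 1 := by omega
      have e3 : a - 1 + b = a + b - 1 := by omega
      have e4 : a + (b + 1) = a + b + 1 := by omega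
      have e5 : 2 * n + 2 - (2 * n + 2 - (a + b + 1)) = a + b + 1 := by omega
      rw [Nat.sub_add_cancel h1] at s1
      rw [e5] at l3
      simp only [ToggledMem, hF.mem_iff, AnMem, column, pathToggle, Function.update_self,
        e1, e2, e3, e4, hp, and_true, true_and, not_true_eq_false, false_and, or_false]
      generalize h (a + b - 1) = x at *
      generalize h (a + b + 1) = z at *
      generalize h (a + b) = y at *
      rw [abs_eq (by norm_num)] at s1 s2
      obtain ⟨c, rfl⟩ : ∃ c : ℤ, y = b - a - 2 * c := ⟨(b - a - y) / 2, by omega⟩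
      replace l1 : x ≤ a + b - 1 := by omega
      replace l3 : z ≤ 2 * n + 1 - a - b := by omega
      clear l2 e1 e2 e3 e4 e5 h1 h2 hF
      by_cases hc : 0 ≤ c
      · have hm : (b : ℤ) - a - 2 * c + a ≤ b := by omega
        simp only [hm, true_and, not_true_eq_false, false_and, or_false]
        rcases abs_cases (x + z - (b - a - 2 * c)) with h3 | h3 <;> rw [h3.1] <;> omega
      · have hm : ¬ (b : ℤ) - a - 2 * c + a ≤ b := by omega
        simp only [hm, false_and, not_false_eq_true, true_and, false_or]
        rcases abs_cases (x + z - (b - a - 2 * c)) with h3 | h3 <;> rw [h3.1] <;> omega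
    · simp only [column, hk, and_false, false_and, not_false_eq_true, true_and, false_or,
        pathToggle, hF.mem_iff, hp]
      rw [Function.update_of_ne hk]
  · simp only [hp, hF.mem_iff, false_and, and_false, or_self]

theorem IsContour.prod_layerToggles {n : ℕ} {F : OFAn n} {h : ℕ → ℤ} (hF : IsContour n F h)
    {r : ℕ} (hr : r ≤ 2 * n + 1) :
    IsContour n ((layerToggles n column r).prod F) (pathSweep r h) := by
  induction r with
  | zero => exact hF
  | succ r ih =>
    rw [layerToggles, List.prod_cons, Equiv.Perm.mul_apply]
    exact (ih (by omega)).wordPerm_layer (by omega) hr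

theorem IsContour.evacProd_layerToggles {n : ℕ} {F : OFAn n} {h : ℕ → ℤ}
    (hF : IsContour n F h) {r : ℕ} (hr : r ≤ 2 * n + 1) :
    IsContour n (evacProd (layerToggles n column r) F) (pathEvac r h) := by
  induction r generalizing F h with
  | zero => exact hF
  | succ r ih =>
    have e : evacProd (layerToggles n column (r + 1)) =
        evacProd (layerToggles n column r) * (layerToggles n column (r + 1)).prod := rfl
    rw [e, Equiv.Perm.mul_apply]
    exact ih (hF.prod_layerToggles hr) (by omega)

/-- Membership in the extension of the order filter `F` by all intervals of `{0, …, n + 1}`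
with an endpoint `0` or `n + 1`. -/
def ExtMem (n : ℕ) (F : Finset (ℕ × ℕ)) (i j : ℕ) : Prop :=
  j ≤ n + 1 ∧ i ≤ j ∧ (i = 0 ∨ j = n + 1 ∨ (i, j) ∈ F)

theorem exists_isContour {n : ℕ} (F : OFAn n) : ∃ h, IsContour n F h := by
  obtain ⟨F, hF⟩ := F
  have hex : ∀ k : ℕ, ∃ d : ℕ, (k ≤ 2 * n + 2 → ∃ i j, i + j = k ∧ i + d = j ∧ ExtMem n F i j) ∧
      ∀ i j, i + j = k → ExtMem n F i j → i + d ≤ j := by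
    intro k
    by_cases hne : ∃ d i j, i + j = k ∧ i + d = j ∧ ExtMem n F i j
    · refine ⟨Nat.find hne, fun _ => Nat.find_spec hne, fun i j hij hm => ?_⟩
      have := Nat.find_min' hne (m := j - i) ⟨i, j, hij, by have := hm.2.1; omega, hm⟩
      have := hm.2.1
      omega
    · refine ⟨0, fun hk => absurd ?_ hne, fun i j hij hm => by have := hm.2.1; omega⟩
      rcases Nat.lt_or_ge (n + 1) k with hk' | hk'
      · exact ⟨n + 1 - (k - (n + 1)), k - (n + 1), n + 1, by omega, by omega, le_rfl, by omega,
          Or.inr (Or.inl rfl)⟩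
      · exact ⟨k, 0, k, by omega, by omega, hk', by omega, Or.inl rfl⟩
  choose h hspec hmin using hex
  refine ⟨fun k => (h k : ℤ), ⟨fun k => Int.natCast_nonneg _, ?_, ?_, fun k hk => ?_⟩, ?_⟩
  · have := hmin 0 0 0 rfl ⟨by omega, le_rfl, Or.inl rfl⟩
    simp only [Nat.cast_eq_zero]
    omega
  · have := hmin (2 * n + 2) (n + 1) (n + 1) (by omega) ⟨by omega, le_rfl, Or.inr (Or.inl rfl)⟩
    simp only [Nat.cast_eq_zero]
    omega
  · obtain ⟨i, j, hij, hd, hm1, hm2, hm3⟩ := hspec k (by omega)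
    obtain ⟨i', j', hij', hd', hm1', hm2', hm3'⟩ := hspec (k + 1) (by omega)
    have up : h (k + 1) ≤ h k + 1 := by
      by_cases hj : j = n + 1
      · have := hmin (k + 1) (i + 1) j (by omega) ⟨hm1, by omega, Or.inr (Or.inl hj)⟩
        omega
      · have : ExtMem n F i (j + 1) := by
          refine ⟨by omega, by omega, ?_⟩
          rcases hm3 with h3 | h3 | h3
          · exact Or.inl h3
          · exact absurd h3 hj
          · by_cases hj' : j = n
            · exact Or.inr (Or.inl (by omega))
            · have h4 := hF.1 _ h3
              simp only [AnMem] at h4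
              exact Or.inr (Or.inr (hF.2 _ h3 _ (by simp only [AnMem]; omega)
                (by simp only [AnLe]; omega)))
        have := hmin (k + 1) i (j + 1) (by omega) this
        omega
    have down : h k ≤ h (k + 1) + 1 := by
      by_cases hi : i' = 0
      · have := hmin k 0 (j' - 1) (by omega) ⟨by omega, by omega, Or.inl rfl⟩
        omega
      · have : ExtMem n F (i' - 1) j' := by
          refine ⟨by omega, by omega, ?_⟩
          rcases hm3' with h3 | h3 | h3
          · exact absurd h3 hi
          · exact Or.inr (Or.inl h3)
          · by_cases hi' : i' = 1
            · exact Or.inl (by omega)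
            · have h4 := hF.1 _ h3
              simp only [AnMem] at h4
              exact Or.inr (Or.inr (hF.2 _ h3 _ (by simp only [AnMem]; omega)
                (by simp only [AnLe]; omega)))
        have := hmin k (i' - 1) j' (by omega) this
        omega
    rw [abs_eq (by norm_num)]
    omega
  · rintro ⟨a, b⟩
    constructor
    · intro hab
      have hm := hF.1 _ hab
      refine ⟨hm, ?_⟩
      simp only [AnMem] at hm
      have := hmin (a + b) a b rfl ⟨by omega, by omega, Or.inr (Or.inr hab)⟩
      simp only
      omega
    · rintro ⟨hm, hle⟩
      have hm' := hm
      simp only [AnMem] at hm' hle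
      obtain ⟨i, j, hij, hd, h1, h2, h3⟩ := hspec (a + b) (by omega)
      have hF' : (i, j) ∈ F := by
        rcases h3 with h3 | h3 | h3
        · omega
        · omega
        · exact h3
      exact hF.2 _ hF' _ hm (by simp only [AnLe]; omega)

theorem mem_image_flipPair {n : ℕ} {F : Finset (ℕ × ℕ)} (hF : IsOFAn n F) (p : ℕ × ℕ) :
    p ∈ F.image (flipPair n) ↔ AnMem n p ∧ flipPair n p ∈ F := by
  rw [Finset.mem_image]
  constructor
  · rintro ⟨q, hq, rfl⟩
    have hm := hF.1 q hq
    rw [flipPair_flipPair n q hm]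
    refine ⟨?_, hq⟩
    simp only [AnMem, flipPair] at *
    omega
  · rintro ⟨hm, hp⟩
    exact ⟨flipPair n p, hp, flipPair_flipPair n p hm⟩

theorem mem_flipPerm {n : ℕ} (F : OFAn n) (p : ℕ × ℕ) :
    p ∈ (flipPerm n F).val ↔ AnMem n p ∧ flipPair n p ∈ F.val := by
  have hO : IsOFAn n (F.val.image (flipPair n)) := by
    refine ⟨fun p hp => ((mem_image_flipPair F.2 p).1 hp).1, fun p hp q hq hpq => ?_⟩
    rw [mem_image_flipPair F.2] at hp ⊢
    refine ⟨hq, F.2.2 _ hp.2 _ ?_ ?_⟩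
    · simp only [AnMem, flipPair] at *
      omega
    · simp only [AnLe, AnMem, flipPair] at *
      omega
  change p ∈ (flipFun n F).val ↔ _
  unfold flipFun
  rw [dif_pos hO]
  exact mem_image_flipPair F.2 p

/-- Evacuation by column toggles reverses Dyck paths. -/
theorem evacProd_column_eq_flipPerm (n : ℕ) :
    evacProd (layerToggles n column (2 * n + 1)) = flipPerm n := by
  ext F ⟨a, b⟩
  obtain ⟨h, hF⟩ := exists_isContour F
  have hd := hF.isDyck
  have hd' : IsDyck n (growthPath (2 * n + 2) h 0) := by
    refine ⟨fun k => ?_, ?_, ?_, fun k hk => ?_⟩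
    · unfold growthPath
      split_ifs with hk
      · rw [hd.treeDist_zero_left]; exact hd.nonneg k
      · rw [hd.treeDist_last (by omega)]; exact hd.nonneg _
    · rw [hd.growthPath_zero (by omega), hd.zero]
    · rw [hd.growthPath_zero le_rfl, hd.last]
    · rw [hd.growthPath_zero hk, hd.growthPath_zero hk.le]
      exact hd.step k hk
  have hE := (hF.congr hd' fun k hk => (hd.growthPath_zero hk).symm).evacProd_layerToggles
    (r := 2 * n + 1) le_rfl
  rw [pathEvac_growthPath hd.step (by omega)] at hE
  rw [hE.mem_iff, mem_flipPerm, hF.mem_iff]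
  refine and_congr_right fun hp => ?_
  simp only [AnMem, flipPair] at *
  have e : n + 1 - b + (n + 1 - a) = 2 * n + 2 - (a + b) := by omega
  rw [hd.growthPath_last (by omega) (by omega), e]
  omega

end Columns

/-- For every `n ≥ 1`, the composite `Rvac_F ∘ Row_F` is conjugate to
`Flip` in the order filter toggle group of `Aⁿ`: there is an element `g` of the subgroup
of permutations of `F(Aⁿ)` generated by the order filter toggles `{t_p : p ∈ Aⁿ}` with
`g ∘ (Rvac_F ∘ Row_F) ∘ g⁻¹ = Flip`. -/
theorem stmt18 (n : ℕ) (hn : 1 ≤ n) :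
    ∃ g ∈ Subgroup.closure ((fun p => togglePerm n p) '' {p : ℕ × ℕ | AnMem n p}),
      g * (RvacPermAn n * RowPermAn n) * g⁻¹ = flipPerm n := by
  obtain ⟨g, hg, e⟩ := (isLayering_corank n).exists_conj (n + 1)
  obtain ⟨g', hg', e'⟩ := (isLayering_column n).exists_conj (2 * n + 1)
  obtain ⟨L, hL, eL, mL⟩ := (isLayering_corank n).exists_altProd_eq (n + 1)
  obtain ⟨L', hL', eL', mL'⟩ := (isLayering_column n).exists_altProd_eq (2 * n + 1)
  have hLL : wordPerm n L = wordPerm n L' := by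
    refine hL.wordPerm_congr hL' fun p => ?_
    rw [mL, mL']
    refine and_congr_right fun hp => ?_
    simp only [AnMem, corank, column] at *
    omega
  rw [eL, hLL, ← eL', ← e', evacProd_column_eq_flipPerm, ← RvacPermAn_mul_RowPermAn] at e
  refine ⟨g'⁻¹ * g, mul_mem (inv_mem hg') hg, ?_⟩
  calc g'⁻¹ * g * (RvacPermAn n * RowPermAn n) * (g'⁻¹ * g)⁻¹
      = g'⁻¹ * (g * (RvacPermAn n * RowPermAn n) * g⁻¹) * g' := by group
    _ = flipPerm n := by rw [e]; group
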